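/- (Theorem 3: a Δ-minimizing subset never partially encloses an outside polygon.) Let ι be an index type, V : ι → Finset (ℝ²) assign nonempty finite vertex sets such that each polygon convexHull ℝ (V i) has nonempty interior, and let C be a finset of indices. Suppose the nonempty finset S ⊆ C minimizes Δ over all subsets of C, i.e. Δ(S) ≤ Δ(T) for every finset T ⊆ C. Then for every index j ∈ C \ S, the interior of the polygon convexHull ℝ (V j) is disjoint from the convex hull convexHull ℝ (⋃_{i∈S} (V i : Set ℝ²)): no point strictly inside an excluded polygon is enclosed by the convex hull of S. -/

import Mathlib

open MeasureTheory

/-- The perimeter of a set in the Euclidean plane: the one-dimensional Hausdorff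
measure of its topological frontier. -/
noncomputable def perim (s : Set (EuclideanSpace ℝ (Fin 2))) : ℝ :=
  (μH[1] (frontier s)).toReal

/-- `hullPerim V F`: the perimeter of the convex hull of the union of the convex
polygons (given by their vertex sets `V i`) indexed by the finset `F`. -/
noncomputable def hullPerim {ι : Type*} (V : ι → Finset (EuclideanSpace ℝ (Fin 2)))
    (F : Finset ι) : ℝ :=
  perim (convexHull ℝ (⋃ i ∈ F, (V i : Set (EuclideanSpace ℝ (Fin 2)))))

/-- `delta V F = H(F) - ∑_{i ∈ F} H({i})`: the change in total perimeter caused by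
merging the polygons indexed by `F` into a single convex hull. -/
noncomputable def delta {ι : Type*} (V : ι → Finset (EuclideanSpace ℝ (Fin 2)))
    (F : Finset ι) : ℝ :=
  hullPerim V F - ∑ i ∈ F, hullPerim V {i}

/-- The Euclidean plane. -/
abbrev Plane := EuclideanSpace ℝ (Fin 2)

/-- Rotation by a quarter turn. -/
def quarterTurn (u : Plane) : Plane := !₂[-u 1, u 0]

theorem inner_plane (x y : Plane) : inner ℝ x y = x 0 * y 0 + x 1 * y 1 := by
  simp [PiLp.inner_apply, Fin.sum_univ_two, mul_comm]

theorem norm_quarterTurn (u : Plane) : ‖quarterTurn u‖ = ‖u‖ := by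
  simp [EuclideanSpace.norm_eq, Fin.sum_univ_two, quarterTurn, add_comm]

/-- A line missing the origin has a unique equation of the form `⟪u, x⟫ = 1`. -/
theorem eq_of_inner_eq_one {x y u v : Plane} (hxy : x ≠ y)
    (hxu : inner ℝ u x = 1) (hyu : inner ℝ u y = 1)
    (hxv : inner ℝ v x = 1) (hyv : inner ℝ v y = 1) : u = v := by
  simp only [inner_plane] at *
  have hdet : x 0 * y 1 - x 1 * y 0 ≠ 0 := by
    intro h
    apply hxy
    ext i
    fin_cases i
    · simp only [Fin.zero_eta]
      linear_combination x 0 * (-hyu) + y 0 * hxu + u 1 * h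
    · simp only [Fin.mk_one]
      linear_combination x 1 * (-hyu) + y 1 * hxu - u 0 * h
  ext i
  fin_cases i
  · simp only [Fin.zero_eta]
    apply mul_left_cancel₀ hdet
    linear_combination y 1 * (hxu - hxv) - x 1 * (hyu - hyv)
  · simp only [Fin.mk_one]
    apply mul_left_cancel₀ hdet
    linear_combination x 0 * (hyu - hyv) - y 0 * (hxu - hxv)

/-- A face of a convex hull is the convex hull of the vertices it contains. -/
theorem mem_convexHull_face {V : Set Plane} {u p : Plane}
    (hp : p ∈ convexHull ℝ V) (hV : ∀ v ∈ V, inner ℝ u v ≤ 1) (hpu : inner ℝ u p = 1) :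
    p ∈ convexHull ℝ {v ∈ V | inner ℝ u v = 1} := by
  rw [convexHull_eq] at hp
  obtain ⟨ι, t, w, z, hw0, hw1, hz, rfl⟩ := hp
  have hzero : ∀ i ∈ t, w i * (1 - inner ℝ u (z i)) = 0 := by
    rw [← Finset.sum_eq_zero_iff_of_nonneg
      (fun i hi => mul_nonneg (hw0 i hi) (sub_nonneg.2 (hV _ (hz i hi))))]
    rw [Finset.centerMass_eq_of_sum_1 _ _ hw1, inner_sum] at hpu
    simp only [inner_smul_right] at hpu
    simp only [mul_sub, mul_one, Finset.sum_sub_distrib, hw1, hpu, sub_self]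
  rw [← Finset.centerMass_filter_ne_zero]
  apply Finset.centerMass_mem_convexHull
  · intro i hi
    exact hw0 i (Finset.mem_filter.1 hi).1
  · rw [Finset.sum_filter_ne_zero, hw1]
    exact one_pos
  · intro i hi
    obtain ⟨hi, hwi⟩ := Finset.mem_filter.1 hi
    refine ⟨hz i hi, ?_⟩
    have := (mul_eq_zero.1 (hzero i hi)).resolve_left hwi
    linarith

theorem inner_quarterTurn_self (u : Plane) : inner ℝ (quarterTurn u) u = 0 := by
  simp [inner_plane, quarterTurn]
  ring

/-- The length of a subset of a line is at most the length of any set whose orthogonal projection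
covers it. -/
theorem hausdorffMeasure_le_of_inner_eq_one {u : Plane} {Q A : Set Plane} (hu : u ≠ 0)
    (hQ : ∀ p ∈ Q, inner ℝ u p = 1)
    (hQA : ∀ p ∈ Q, ∃ q ∈ A, inner ℝ (quarterTurn u) q = inner ℝ (quarterTurn u) p) :
    μH[1] Q ≤ μH[1] A := by
  have hn : 0 < ‖u‖ := norm_pos_iff.2 hu
  let π : Plane → Plane := fun y => y + ((1 - inner ℝ u y) / ‖u‖ ^ 2) • u
  have hnu : ‖u‖ ^ 2 = u 0 ^ 2 + u 1 ^ 2 := by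
    rw [← real_inner_self_eq_norm_sq, inner_plane]
    ring
  have hπ : LipschitzWith 1 π := by
    apply LipschitzWith.mk_one
    intro x y
    have hd : π x - π y = (x - y) - (inner ℝ u (x - y) / ‖u‖ ^ 2) • u := by
      simp only [π, inner_sub_right]
      module
    rw [dist_eq_norm, dist_eq_norm, hd]
    refine le_of_sq_le_sq ?_ (norm_nonneg _)
    rw [norm_sub_sq_real, inner_smul_right, norm_smul, mul_pow, Real.norm_eq_abs, sq_abs,
      real_inner_comm u (x - y)]
    have : inner ℝ u (x - y) / ‖u‖ ^ 2 * inner ℝ u (x - y)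
        = (inner ℝ u (x - y) / ‖u‖ ^ 2) ^ 2 * ‖u‖ ^ 2 := by
      field_simp
    have h0 : 0 ≤ (inner ℝ u (x - y) / ‖u‖ ^ 2) ^ 2 * ‖u‖ ^ 2 := by positivity
    linarith
  have hsub : Q ⊆ π '' A := by
    intro p hp
    obtain ⟨q, hq, hqp⟩ := hQA p hp
    refine ⟨q, hq, ?_⟩
    have h1 := hQ p hp
    have h2 : u 0 ^ 2 + u 1 ^ 2 ≠ 0 := by
      rw [← hnu]
      positivity
    simp only [inner_plane, quarterTurn] at hqp h1
    simp at hqp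
    ext i
    simp only [π, PiLp.add_apply, PiLp.smul_apply, smul_eq_mul, hnu, inner_plane]
    rw [← h1]
    fin_cases i
    · simp only [Fin.zero_eta]
      field_simp
      linear_combination -u 1 * hqp
    · simp only [Fin.mk_one]
      field_simp
      linear_combination u 0 * hqp
  calc μH[1] Q ≤ μH[1] (π '' A) := measure_mono hsub
    _ ≤ (1 : NNReal) ^ (1 : ℝ) * μH[1] A := hπ.hausdorffMeasure_image_le zero_le_one A
    _ = μH[1] A := by simp

theorem hausdorffMeasure_inner_eq_one_lt_top {u : Plane} {Q : Set Plane}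
    (hQ : ∀ p ∈ Q, inner ℝ u p = 1) (hb : Bornology.IsBounded Q) : μH[1] Q < ⊤ := by
  obtain rfl | hu := eq_or_ne u 0
  · have : Q = ∅ := by
      ext p
      simpa using hQ p
    simp [this]
  obtain ⟨R, hR⟩ := hb.exists_norm_le
  have hn : 0 < ‖u‖ := norm_pos_iff.2 hu
  let w := quarterTurn u
  have hww : inner ℝ w w = ‖u‖ ^ 2 := by
    rw [real_inner_self_eq_norm_sq, norm_quarterTurn]
  have hwu : inner ℝ w u = 0 := inner_quarterTurn_self u
  let x : Plane := (‖u‖ ^ 2)⁻¹ • (u - (R * ‖u‖) • w)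
  let y : Plane := (‖u‖ ^ 2)⁻¹ • (u + (R * ‖u‖) • w)
  refine (hausdorffMeasure_le_of_inner_eq_one (A := segment ℝ x y) hu hQ ?_).trans_lt ?_
  · intro p hp
    have hp' : |inner ℝ w p| ≤ R * ‖u‖ := by
      refine (abs_real_inner_le_norm _ _).trans ?_
      rw [norm_quarterTurn, mul_comm]
      exact mul_le_mul_of_nonneg_right (hR p hp) hn.le
    rw [abs_le] at hp'
    have himg : innerSL ℝ w '' segment ℝ x y = Set.uIcc (inner ℝ w x) (inner ℝ w y) := by
      rw [← segment_eq_uIcc]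
      exact image_segment ℝ (innerSL ℝ w).toLinearMap.toAffineMap x y
    have hx : inner ℝ w x = -(R * ‖u‖) := by
      simp only [x, inner_smul_right, inner_sub_right, hwu, hww]
      field_simp
      ring
    have hy : inner ℝ w y = R * ‖u‖ := by
      simp only [y, inner_smul_right, inner_add_right, hwu, hww]
      field_simp
      ring
    have : inner ℝ w p ∈ innerSL ℝ w '' segment ℝ x y := by
      rw [himg, hx, hy]
      exact Set.Icc_subset_uIcc hp'
    exact this
  · rw [hausdorffMeasure_segment]
    exact edist_lt_top _ _

theorem IsPreconnected.nonempty_inter_frontier {X : Type*} [TopologicalSpace X] {s t : Set X}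
    (ht : IsPreconnected t) (h : (t ∩ s).Nonempty) (h' : (t ∩ sᶜ).Nonempty) :
    (t ∩ frontier s).Nonempty := by
  by_contra hne
  have hd : ∀ x ∈ t, x ∉ frontier s := fun x hx hxs => hne ⟨x, hx, hxs⟩
  have key : ∀ x ∈ t, x ∈ closure s → x ∈ interior s := fun x hx hxs => by
    by_contra hxi
    exact hd x hx ⟨hxs, hxi⟩
  obtain ⟨x, hx, hxs⟩ := h
  obtain ⟨y, hy, hys⟩ := h'
  obtain ⟨z, -, hz1, hz2⟩ := ht (interior s) (closure s)ᶜ isOpen_interior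
    isClosed_closure.isOpen_compl
    (fun z hz => by
      by_cases hzs : z ∈ closure s
      · exact Or.inl (key z hz hzs)
      · exact Or.inr hzs)
    ⟨x, hx, key x hx (subset_closure hxs)⟩
    ⟨y, hy, fun hyc => hys (interior_subset (key y hy hyc))⟩
  exact hz2 (subset_closure (interior_subset hz1))

/-- A null set for the one-dimensional Hausdorff measure cannot separate points of an open convex
set in the plane. -/
theorem hausdorffMeasure_inter_frontier_pos {B K : Set Plane} (hB : IsOpen B) (hBc : Convex ℝ B)
    {x y : Plane} (hx : x ∈ B) (hxK : x ∈ interior K) (hy : y ∈ B) (hyK : y ∈ interior Kᶜ) :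
    0 < μH[1] (B ∩ frontier K) := by
  have hxy : y - x ≠ 0 := by
    rintro h
    rw [sub_eq_zero.1 h] at hyK
    exact interior_subset hyK (interior_subset hxK)
  set w := quarterTurn (y - x)
  have hw : w ≠ 0 := by
    rw [← norm_pos_iff, norm_quarterTurn, norm_pos_iff]
    exact hxy
  let O : Set Plane := (B ∩ interior K) ∩ (fun z => z + (y - x)) ⁻¹' (B ∩ interior Kᶜ)
  have hO : IsOpen O := (hB.inter isOpen_interior).inter
    ((hB.inter isOpen_interior).preimage (by fun_prop))
  have hxO : x ∈ O := ⟨⟨hx, hxK⟩, by simpa using ⟨hy, by simpa using hyK⟩⟩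
  have hsurj : Function.Surjective (innerSL ℝ w) := by
    intro t
    refine ⟨(t / ‖w‖ ^ 2) • w, ?_⟩
    rw [innerSL_apply_apply, inner_smul_right, real_inner_self_eq_norm_sq]
    field_simp [norm_ne_zero_iff.2 hw]
  have hOw : IsOpen (innerSL ℝ w '' O) := (innerSL ℝ w).isOpenMap hsurj _ hO
  have hsub : innerSL ℝ w '' O ⊆ innerSL ℝ w '' (B ∩ frontier K) := by
    rintro _ ⟨z, ⟨⟨hzB, hzK⟩, hzB', hzK'⟩, rfl⟩
    obtain ⟨q, hq, hqK⟩ := (convex_segment z (z + (y - x))).isPreconnected.nonempty_inter_frontier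
      ⟨z, left_mem_segment ℝ _ _, interior_subset hzK⟩
      ⟨_, right_mem_segment ℝ _ _, interior_subset hzK'⟩
    refine ⟨q, ⟨hBc.segment_subset hzB hzB' hq, hqK⟩, ?_⟩
    rw [segment_eq_image'] at hq
    obtain ⟨t, -, rfl⟩ := hq
    simp [w, inner_quarterTurn_self, inner_add_right, inner_smul_right]
  have h1 : 0 < μH[1] (innerSL ℝ w '' (B ∩ frontier K)) := by
    rw [hausdorffMeasure_real]
    exact (hOw.measure_pos volume ⟨_, x, hxO, rfl⟩).trans_le (measure_mono hsub)
  have h2 := (innerSL ℝ w).lipschitz.hausdorffMeasure_image_le zero_le_one (B ∩ frontier K)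
  rw [pos_iff_ne_zero]
  intro h
  rw [h, mul_zero] at h2
  exact absurd h2 (not_le.2 h1)

/-- Vectors `u` such that `⟪u, x⟫ = 1` is the equation of an edge line of `convexHull ℝ V`, with
the hull on the side `⟪u, x⟫ ≤ 1`. -/
def edgeNormals (V : Set Plane) : Set Plane :=
  {u | (∀ v ∈ V, inner ℝ u v ≤ 1) ∧ {v ∈ V | inner ℝ u v = 1}.Nontrivial}

/-- The part of `convexHull ℝ V` on the line `⟪u, x⟫ = 1`. -/
def edge (V : Set Plane) (u : Plane) : Set Plane :=
  convexHull ℝ {v ∈ V | inner ℝ u v = 1}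

theorem finite_edgeNormals {V : Set Plane} (hV : V.Finite) : (edgeNormals V).Finite := by
  have h : ∀ u ∈ edgeNormals V, ∃ q : Plane × Plane, q ∈ V ×ˢ V ∧ q.1 ≠ q.2 ∧
      inner ℝ u q.1 = 1 ∧ inner ℝ u q.2 = 1 := by
    rintro u ⟨-, a, ha, b, hb, hab⟩
    exact ⟨(a, b), ⟨ha.1, hb.1⟩, hab, ha.2, hb.2⟩
  choose! f hf hne h1 h2 using h
  refine Set.Finite.of_injOn (f := f) (t := V ×ˢ V) (fun u hu => hf u hu) ?_ (hV.prod hV)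
  intro u hu v hv huv
  exact eq_of_inner_eq_one (hne u hu) (h1 u hu) (h2 u hu) (huv ▸ h1 v hv) (huv ▸ h2 v hv)

theorem convex_inner_eq (u : Plane) (r : ℝ) : Convex ℝ {x : Plane | inner ℝ u x = r} :=
  convex_hyperplane (innerSL ℝ u).toLinearMap.isLinear r

theorem inner_eq_one_of_mem_edge {V : Set Plane} {u p : Plane} (hp : p ∈ edge V u) :
    inner ℝ u p = 1 :=
  convexHull_min (fun _ hv => hv.2) (convex_inner_eq u 1) hp

theorem edge_subset (V : Set Plane) (u : Plane) : edge V u ⊆ convexHull ℝ V :=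
  convexHull_mono (Set.sep_subset _ _)

theorem inner_le_one_of_mem_convexHull {V : Set Plane} {u p : Plane} (hu : u ∈ edgeNormals V)
    (hp : p ∈ convexHull ℝ V) : inner ℝ u p ≤ 1 :=
  convexHull_min hu.1 (convex_halfSpace_le (innerSL ℝ u).toLinearMap.isLinear 1) hp

theorem frontier_subset_edges {V : Set Plane} (hV : V.Finite)
    (h0 : (0 : Plane) ∈ interior (convexHull ℝ V)) :
    frontier (convexHull ℝ V) ⊆ V ∪ ⋃ u ∈ edgeNormals V, edge V u := by
  intro p hp
  have hcl : IsClosed (convexHull ℝ V) := (hV.isCompact_convexHull ℝ).isClosed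
  have hconv := convex_convexHull ℝ V
  obtain ⟨f, hf⟩ := geometric_hahn_banach_open_point hconv.interior isOpen_interior hp.2
  have hfp : 0 < f p := by simpa using hf 0 h0
  have hfV : ∀ v ∈ V, f v ≤ f p := by
    intro v hv
    have hvc : v ∈ closure (interior (convexHull ℝ V)) := by
      rw [hconv.closure_interior_eq_closure_of_nonempty_interior ⟨0, h0⟩]
      exact subset_closure (subset_convexHull ℝ V hv)
    exact closure_minimal (fun x hx => (hf x hx).le)
      (isClosed_le f.continuous continuous_const) hvc
  set u : Plane := (f p)⁻¹ • (InnerProductSpace.toDual ℝ Plane).symm f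
  have hu : ∀ x, inner ℝ u x = (f p)⁻¹ * f x := by
    intro x
    simp [u, inner_smul_left]
  have huV : ∀ v ∈ V, inner ℝ u v ≤ 1 := by
    intro v hv
    rw [hu, inv_mul_le_iff₀ hfp, mul_one]
    exact hfV v hv
  have hup : inner ℝ u p = 1 := by
    rw [hu, inv_mul_cancel₀ hfp.ne']
  have hpV : p ∈ convexHull ℝ V := hcl.frontier_subset hp
  have hpe := mem_convexHull_face hpV huV hup
  by_cases hnt : {v ∈ V | inner ℝ u v = 1}.Nontrivial
  · exact Or.inr (Set.mem_biUnion (show u ∈ edgeNormals V from ⟨huV, hnt⟩) hpe)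
  · rw [Set.not_nontrivial_iff] at hnt
    obtain h | ⟨v, h⟩ := hnt.eq_empty_or_singleton
    · simp [h] at hpe
    · rw [h, convexHull_singleton, Set.mem_singleton_iff] at hpe
      have : v ∈ {v ∈ V | inner ℝ u v = 1} := by simp [h]
      exact Or.inl (hpe ▸ this.1)

theorem hausdorffMeasure_of_finite {s : Set Plane} (hs : s.Finite) : μH[1] s = 0 := by
  have := Measure.nullSingletonClass_hausdorff Plane one_pos
  exact hs.measure_zero _

theorem hausdorffMeasure_frontier_le {V : Set Plane} (hV : V.Finite)
    (h0 : (0 : Plane) ∈ interior (convexHull ℝ V)) :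
    μH[1] (frontier (convexHull ℝ V)) ≤
      ∑ u ∈ (finite_edgeNormals hV).toFinset, μH[1] (edge V u) := by
  calc μH[1] (frontier (convexHull ℝ V))
      ≤ μH[1] (V ∪ ⋃ u ∈ (finite_edgeNormals hV).toFinset, edge V u) := by
        refine measure_mono ((frontier_subset_edges hV h0).trans ?_)
        simp
    _ ≤ μH[1] V + μH[1] (⋃ u ∈ (finite_edgeNormals hV).toFinset, edge V u) :=
        measure_union_le _ _
    _ ≤ _ := by
        rw [hausdorffMeasure_of_finite hV, zero_add]
        exact measure_biUnion_finset_le _ _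

theorem hausdorffMeasure_frontier_lt_top {V : Set Plane} (hV : V.Finite)
    (h0 : (0 : Plane) ∈ interior (convexHull ℝ V)) :
    μH[1] (frontier (convexHull ℝ V)) < ⊤ := by
  refine (hausdorffMeasure_frontier_le hV h0).trans_lt (ENNReal.sum_lt_top.2 fun u _ => ?_)
  exact hausdorffMeasure_inner_eq_one_lt_top (fun _ => inner_eq_one_of_mem_edge)
    ((hV.isCompact_convexHull ℝ).isBounded.subset (edge_subset V u))

theorem exists_smul_mem_edge {V : Set Plane} {u q : Plane} (hu : u ∈ edgeNormals V)
    (hq : q ∈ convexHull ℝ (insert 0 {v ∈ V | inner ℝ u v = 1})) (hq0 : q ≠ 0) :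
    ∃ s : ℝ, 0 < s ∧ ∃ x ∈ edge V u, q = s • x := by
  rw [convexHull_insert hu.2.nonempty, mem_convexJoin] at hq
  obtain ⟨_, rfl, x, hx, hq⟩ := hq
  rw [segment_eq_image'] at hq
  obtain ⟨s, hs, rfl⟩ := hq
  simp only [sub_zero, zero_add] at hq0 ⊢
  exact ⟨s, hs.1.lt_of_ne' (fun h => hq0 (by simp [h])), x, hx, rfl⟩

theorem exists_smul_mem_edge_inter {V : Set Plane} {u v q : Plane} (hu : u ∈ edgeNormals V)
    (hv : v ∈ edgeNormals V) (hqu : q ∈ convexHull ℝ (insert 0 {x ∈ V | inner ℝ u x = 1}))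
    (hqv : q ∈ convexHull ℝ (insert 0 {x ∈ V | inner ℝ v x = 1})) (hq0 : q ≠ 0) :
    ∃ s : ℝ, 0 < s ∧ ∃ x ∈ edge V u ∩ edge V v, q = s • x := by
  obtain ⟨s, hs, x, hx, rfl⟩ := exists_smul_mem_edge hu hqu hq0
  obtain ⟨t, ht, y, hy, hxy⟩ := exists_smul_mem_edge hv hqv hq0
  have h1 : s = t * inner ℝ u y := by
    rw [← inner_smul_right, ← hxy, inner_smul_right, inner_eq_one_of_mem_edge hx, mul_one]
  have h2 : s * inner ℝ v x = t := by
    rw [← inner_smul_right, hxy, inner_smul_right, inner_eq_one_of_mem_edge hy, mul_one]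
  have h3 := inner_le_one_of_mem_convexHull hu (edge_subset V v hy)
  have h4 := inner_le_one_of_mem_convexHull hv (edge_subset V u hx)
  have hst : s = t := by
    apply le_antisymm
    · rw [h1]
      exact mul_le_of_le_one_right ht.le h3
    · rw [← h2]
      exact mul_le_of_le_one_right hs.le h4
  subst hst
  rw [smul_right_injective Plane hs.ne' hxy] at hx ⊢
  exact ⟨s, hs, y, ⟨hx, hy⟩, rfl⟩

theorem subsingleton_edge_inter {V : Set Plane} {u v : Plane} (huv : u ≠ v) :
    (edge V u ∩ edge V v).Subsingleton := by
  intro x hx y hy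
  by_contra hxy
  exact huv (eq_of_inner_eq_one hxy (inner_eq_one_of_mem_edge hx.1) (inner_eq_one_of_mem_edge hy.1)
    (inner_eq_one_of_mem_edge hx.2) (inner_eq_one_of_mem_edge hy.2))

theorem smul_mem_interior_union {K P : Set Plane} (hK : Convex ℝ K) (hP : Convex ℝ P)
    (hK0 : (0 : Plane) ∈ interior K) (hP0 : (0 : Plane) ∈ interior P) {q : Plane}
    (hq : q ∈ K ∪ P) {t : ℝ} (ht0 : 0 ≤ t) (ht1 : t < 1) : t • q ∈ interior (K ∪ P) := by
  have key : ∀ M : Set Plane, Convex ℝ M → (0 : Plane) ∈ interior M → q ∈ M →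
      t • q ∈ interior M := by
    intro M hM h0 hqM
    have := hM.combo_interior_self_mem_interior h0 hqM (sub_pos.2 ht1) ht0 (by ring)
    simpa using this
  obtain hq | hq := hq
  · exact interior_mono Set.subset_union_left (key K hK hK0 hq)
  · exact interior_mono Set.subset_union_right (key P hP hP0 hq)

/-- Every point of an edge of the hull of two overlapping polygons projects, along the normal of
the edge, to a boundary point of their union inside the triangle spanned by the edge and the
origin. -/
theorem exists_mem_frontier_union_inner_eq {A B : Set Plane} (hA : A.Finite) (hB : B.Finite)
    (hA0 : (0 : Plane) ∈ convexHull ℝ A) (hB0 : (0 : Plane) ∈ convexHull ℝ B) {u p : Plane}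
    (hu : u ∈ edgeNormals (A ∪ B)) (hp : p ∈ edge (A ∪ B) u) :
    ∃ q ∈ frontier (convexHull ℝ A ∪ convexHull ℝ B) ∩
        convexHull ℝ (insert 0 {v ∈ A ∪ B | inner ℝ u v = 1}),
      inner ℝ (quarterTurn u) q = inner ℝ (quarterTurn u) p := by
  set U := convexHull ℝ A ∪ convexHull ℝ B
  set F := {v ∈ A ∪ B | inner ℝ u v = 1}
  set T := convexHull ℝ (insert 0 F)
  set w := quarterTurn u
  have hUcl : IsClosed U :=
    (hA.isCompact_convexHull ℝ).isClosed.union (hB.isCompact_convexHull ℝ).isClosed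
  have hTc : Convex ℝ T := convex_convexHull ℝ _
  have h0T : (0 : Plane) ∈ T := subset_convexHull ℝ _ (Set.mem_insert _ _)
  have hFT : F ⊆ T := (Set.subset_insert _ _).trans (subset_convexHull ℝ _)
  have hpT : p ∈ T := convexHull_mono (Set.subset_insert _ _) hp
  have hstar : StarConvex ℝ 0 (U ∩ T) :=
    (((convex_convexHull ℝ A).starConvex hA0).union ((convex_convexHull ℝ B).starConvex hB0)).inter
      (hTc.starConvex h0T)
  have h0UT : (0 : Plane) ∈ U ∩ T := ⟨Or.inl hA0, h0T⟩
  have hconn : IsPreconnected (innerSL ℝ w '' (U ∩ T)) :=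
    (hstar.isPathConnected h0UT).isConnected.isPreconnected.image _
      (innerSL ℝ w).continuous.continuousOn
  have hconv : Convex ℝ (innerSL ℝ w '' (U ∩ T)) :=
    (isPreconnected_iff_ordConnected.1 hconn).convex
  have hFU : F ⊆ U := fun v hv =>
    hv.1.imp (fun h => subset_convexHull ℝ A h) (fun h => subset_convexHull ℝ B h)
  have hpw : p ∈ innerSL ℝ w ⁻¹' (innerSL ℝ w '' (U ∩ T)) :=
    convexHull_min
      (fun v hv => Set.mem_image_of_mem (innerSL ℝ w) (show v ∈ U ∩ T from ⟨hFU hv, hFT hv⟩))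
      (hconv.linear_preimage (innerSL ℝ w).toLinearMap) hp
  obtain ⟨q, ⟨hqU, hqT⟩, hqp⟩ := hpw
  simp only [innerSL_apply_apply] at hqp
  have hpU : p ∉ interior U := by
    intro h
    have hle : U ⊆ {x | inner ℝ u x ≤ 1} := by
      rintro x (hx | hx)
      · exact inner_le_one_of_mem_convexHull hu (convexHull_mono Set.subset_union_left hx)
      · exact inner_le_one_of_mem_convexHull hu (convexHull_mono Set.subset_union_right hx)
    have hu0 : u ≠ 0 := by
      rintro rfl
      simpa using inner_eq_one_of_mem_edge hp
    have hcont : Continuous fun t : ℝ => p + t • u := by fun_prop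
    have hnhds : ∀ᶠ t in nhds (0 : ℝ), p + t • u ∈ U :=
      hcont.continuousAt.eventually (by simpa using mem_interior_iff_mem_nhds.1 h)
    obtain ⟨t, ht, ht0⟩ := ((hnhds.filter_mono nhdsWithin_le_nhds).and
      (self_mem_nhdsWithin (s := Set.Ioi (0 : ℝ)))).exists
    have h1 : inner ℝ u (p + t • u) ≤ 1 := hle ht
    rw [inner_add_right, inner_smul_right, inner_eq_one_of_mem_edge hp,
      real_inner_self_eq_norm_sq] at h1
    have : 0 < t * ‖u‖ ^ 2 := mul_pos ht0 (by positivity)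
    linarith
  have hline : ∀ z ∈ segment ℝ q p, inner ℝ w z = inner ℝ w p :=
    (convex_inner_eq w (inner ℝ w p)).segment_subset hqp rfl
  by_cases hpU' : p ∈ U
  · exact ⟨p, ⟨⟨subset_closure hpU', hpU⟩, hpT⟩, rfl⟩
  · obtain ⟨z, hz, hzU⟩ := (convex_segment q p).isPreconnected.nonempty_inter_frontier
      ⟨q, left_mem_segment ℝ _ _, hqU⟩ ⟨p, right_mem_segment ℝ _ _, hpU'⟩
    exact ⟨z, ⟨hzU, hTc.segment_subset hqT hpT hz⟩, hline z hz⟩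

/-- The hull of the union of two overlapping polygons has no larger perimeter than the union. -/
theorem hausdorffMeasure_frontier_convexHull_union_le {A B : Set Plane} (hA : A.Finite)
    (hB : B.Finite) (hA0 : (0 : Plane) ∈ interior (convexHull ℝ A))
    (hB0 : (0 : Plane) ∈ interior (convexHull ℝ B)) :
    μH[1] (frontier (convexHull ℝ (A ∪ B))) ≤
      μH[1] (frontier (convexHull ℝ A ∪ convexHull ℝ B)) := by
  set U := convexHull ℝ A ∪ convexHull ℝ B with hU
  have hV := hA.union hB
  have hUcl : IsClosed U :=
    (hA.isCompact_convexHull ℝ).isClosed.union (hB.isCompact_convexHull ℝ).isClosed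
  have h0U : (0 : Plane) ∈ interior U := interior_mono Set.subset_union_left hA0
  let D : Plane → Set Plane := fun u =>
    frontier U ∩ convexHull ℝ (insert 0 {v ∈ A ∪ B | inner ℝ u v = 1})
  have hdisj : ((finite_edgeNormals hV).toFinset : Set Plane).Pairwise
      (Function.onFun (AEDisjoint μH[1]) D) := by
    intro u hu v hv huv
    rw [Set.Finite.coe_toFinset] at hu hv
    refine hausdorffMeasure_of_finite (Set.Subsingleton.finite ?_)
    rintro q ⟨⟨hqU, hqu⟩, -, hqv⟩ q' ⟨⟨hqU', hqu'⟩, -, hqv'⟩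
    have hne : ∀ z ∈ frontier U, z ≠ 0 := by
      rintro z hz rfl
      exact hz.2 h0U
    obtain ⟨s, hs, x, hx, rfl⟩ := exists_smul_mem_edge_inter hu hv hqu hqv (hne q hqU)
    obtain ⟨t, ht, y, hy, rfl⟩ := exists_smul_mem_edge_inter hu hv hqu' hqv' (hne q' hqU')
    obtain rfl := subsingleton_edge_inter huv hx hy
    have hle : ∀ a b : ℝ, 0 < a → 0 < b → a • x ∈ frontier U → b • x ∈ frontier U → b ≤ a := by
      intro a b ha hb haU hbU
      by_contra! hab
      apply haU.2
      have := smul_mem_interior_union (convex_convexHull ℝ A) (convex_convexHull ℝ B) hA0 hB0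
        (hUcl.frontier_subset hbU) (t := a / b) (by positivity) ((div_lt_one hb).2 hab)
      rwa [smul_smul, div_mul_cancel₀ _ hb.ne'] at this
    rw [le_antisymm (hle t s ht hs hqU' hqU) (hle s t hs ht hqU hqU')]
  have hmeas : ∀ u ∈ (finite_edgeNormals hV).toFinset, NullMeasurableSet (D u) μH[1] := by
    intro u _
    have hfin : (insert 0 {v ∈ A ∪ B | inner ℝ u v = 1}).Finite := (hV.sep _).insert 0
    exact (isClosed_frontier.inter
      (hfin.isCompact_convexHull ℝ).isClosed).measurableSet.nullMeasurableSet
  calc μH[1] (frontier (convexHull ℝ (A ∪ B)))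
      ≤ ∑ u ∈ (finite_edgeNormals hV).toFinset, μH[1] (edge (A ∪ B) u) :=
        hausdorffMeasure_frontier_le hV
          (interior_mono (convexHull_mono Set.subset_union_left) hA0)
    _ ≤ ∑ u ∈ (finite_edgeNormals hV).toFinset, μH[1] (D u) := by
        refine Finset.sum_le_sum fun u hu => ?_
        rw [Set.Finite.mem_toFinset] at hu
        refine hausdorffMeasure_le_of_inner_eq_one ?_ (fun _ => inner_eq_one_of_mem_edge)
          fun p hp => exists_mem_frontier_union_inner_eq hA hB (interior_subset hA0)
            (interior_subset hB0) hu hp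
        rintro rfl
        obtain ⟨a, ha⟩ := hu.2.nonempty
        simpa using ha.2
    _ = μH[1] (⋃ u ∈ (finite_edgeNormals hV).toFinset, D u) :=
        (measure_biUnion_finset₀ hdisj hmeas).symm
    _ ≤ μH[1] (frontier U) := measure_mono (Set.iUnion₂_subset fun _ _ => Set.inter_subset_left)

theorem hausdorffMeasure_open_inter_frontier_pos {K O : Set Plane} (hK : Convex ℝ K)
    (hKcl : IsClosed K) (hKi : (interior K).Nonempty) (hO : IsOpen O)
    (h : (O ∩ frontier K).Nonempty) : 0 < μH[1] (O ∩ frontier K) := by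
  obtain ⟨p, hpO, hp⟩ := h
  obtain ⟨r, hr, hrO⟩ := Metric.isOpen_iff.1 hO p hpO
  have h1 : p ∈ closure (interior K) := by
    rw [hK.closure_interior_eq_closure_of_nonempty_interior hKi]
    exact hp.1
  have h2 : p ∈ closure Kᶜ := by
    rw [closure_compl]
    exact hp.2
  obtain ⟨x, hx, hxp⟩ := Metric.mem_closure_iff.1 h1 r hr
  obtain ⟨y, hy, hyp⟩ := Metric.mem_closure_iff.1 h2 r hr
  rw [dist_comm] at hxp hyp
  rw [← hKcl.isOpen_compl.interior_eq] at hy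
  exact (hausdorffMeasure_inter_frontier_pos Metric.isOpen_ball (convex_ball p r) hxp hx hyp
    hy).trans_le (measure_mono (Set.inter_subset_inter_left _ hrO))

theorem hausdorffMeasure_frontier_union_lt {K P : Set Plane} (hK : Convex ℝ K) (hKc : IsCompact K)
    (hPc : Convex ℝ P) (hPcomp : IsCompact P) (h : (interior K ∩ interior P).Nonempty)
    (hKfin : μH[1] (frontier K) < ⊤) (hPfin : μH[1] (frontier P) < ⊤) :
    μH[1] (frontier (K ∪ P)) < μH[1] (frontier K) + μH[1] (frontier P) := by
  have hKcl := hKc.isClosed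
  have hPcl := hPcomp.isClosed
  have hsub : frontier (K ∪ P) ⊆ (frontier K \ interior P) ∪ (frontier P \ K) := by
    intro x hx
    have hxK : x ∉ interior K := fun h => hx.2 (interior_mono Set.subset_union_left h)
    have hxP : x ∉ interior P := fun h => hx.2 (interior_mono Set.subset_union_right h)
    have hxU := (hKcl.union hPcl).frontier_subset hx
    by_cases hxK' : x ∈ K
    · exact Or.inl ⟨⟨subset_closure hxK', hxK⟩, hxP⟩
    · exact Or.inr ⟨⟨subset_closure (hxU.resolve_left hxK'), hxP⟩, hxK'⟩
  have hle : μH[1] (frontier (K ∪ P)) ≤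
      μH[1] (frontier K \ interior P) + μH[1] (frontier P \ K) :=
    (measure_mono hsub).trans (measure_union_le _ _)
  obtain ⟨c, hcK, hcP⟩ := h
  by_cases hne : (interior P ∩ frontier K).Nonempty
  · have hpos := hausdorffMeasure_open_inter_frontier_pos hK hKcl ⟨c, hcK⟩ isOpen_interior hne
    have hsplit := measure_inter_add_sdiff (μ := μH[1]) (frontier K)
      (isOpen_interior (s := P)).measurableSet
    rw [Set.inter_comm] at hsplit
    have hlt : μH[1] (frontier K \ interior P) < μH[1] (frontier K) := by
      rw [← hsplit, add_comm]
      refine ENNReal.lt_add_right ?_ hpos.ne'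
      exact ((measure_mono Set.sdiff_subset).trans_lt hKfin).ne
    exact hle.trans_lt (ENNReal.add_lt_add_of_lt_of_le
      ((measure_mono Set.sdiff_subset).trans_lt hPfin).ne hlt (measure_mono Set.sdiff_subset))
  · have hPK : P ⊆ K := by
      have hint : interior P ⊆ K := by
        intro x hx
        by_contra hxK
        exact hne (hPc.interior.isPreconnected.nonempty_inter_frontier
          ⟨c, hcP, interior_subset hcK⟩ ⟨x, hx, hxK⟩)
      refine subset_closure.trans ?_
      rw [← hPc.closure_interior_eq_closure_of_nonempty_interior ⟨c, hcP⟩]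
      exact closure_minimal hint hKcl
    rw [Set.union_eq_self_of_subset_right hPK]
    refine ENNReal.lt_add_right hKfin.ne ?_
    have hPne : (frontier P).Nonempty := by
      rw [nonempty_frontier_iff]
      exact ⟨⟨c, interior_subset hcP⟩, hPcomp.ne_univ⟩
    have := hausdorffMeasure_open_inter_frontier_pos hPc hPcl ⟨c, hcP⟩ isOpen_univ
      (by simpa using hPne)
    rw [Set.univ_inter] at this
    exact this.ne'

open scoped Pointwise in
theorem hausdorffMeasure_frontier_convexHull_vadd (c : Plane) (A : Set Plane) :
    μH[1] (frontier (convexHull ℝ (c +ᵥ A))) = μH[1] (frontier (convexHull ℝ A)) := by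
  rw [convexHull_vadd]
  have : frontier (c +ᵥ convexHull ℝ A) = c +ᵥ frontier (convexHull ℝ A) :=
    ((Homeomorph.vadd c).image_frontier _).symm
  rw [this]
  exact (IsometryEquiv.constVAdd c).hausdorffMeasure_image 1 _

open scoped Pointwise in
theorem exists_vadd_zero_mem_interior {A : Set Plane} {c : Plane}
    (hA : c ∈ interior (convexHull ℝ A)) : (0 : Plane) ∈ interior (convexHull ℝ (-c +ᵥ A)) := by
  have : interior (-c +ᵥ convexHull ℝ A) = -c +ᵥ interior (convexHull ℝ A) :=
    ((Homeomorph.vadd (-c)).image_interior _).symm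
  rw [convexHull_vadd, this]
  exact ⟨c, hA, by simp⟩

open scoped Pointwise in
theorem hausdorffMeasure_frontier_convexHull_lt_top {A : Set Plane} (hA : A.Finite)
    (h : (interior (convexHull ℝ A)).Nonempty) : μH[1] (frontier (convexHull ℝ A)) < ⊤ := by
  obtain ⟨c, hc⟩ := h
  rw [← hausdorffMeasure_frontier_convexHull_vadd (-c)]
  exact hausdorffMeasure_frontier_lt_top (hA.image _) (exists_vadd_zero_mem_interior hc)

open scoped Pointwise in
/-- Merging two overlapping convex polygons strictly decreases the total perimeter. -/
theorem perim_convexHull_union_lt {A B : Set Plane} (hA : A.Finite) (hB : B.Finite)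
    (h : (interior (convexHull ℝ A) ∩ interior (convexHull ℝ B)).Nonempty) :
    perim (convexHull ℝ (A ∪ B)) < perim (convexHull ℝ A) + perim (convexHull ℝ B) := by
  obtain ⟨c, hcA, hcB⟩ := h
  have hAfin := hausdorffMeasure_frontier_convexHull_lt_top hA ⟨c, hcA⟩
  have hBfin := hausdorffMeasure_frontier_convexHull_lt_top hB ⟨c, hcB⟩
  have hlt : μH[1] (frontier (convexHull ℝ (A ∪ B))) <
      μH[1] (frontier (convexHull ℝ A)) + μH[1] (frontier (convexHull ℝ B)) := by
    rw [← hausdorffMeasure_frontier_convexHull_vadd (-c) A,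
      ← hausdorffMeasure_frontier_convexHull_vadd (-c) B,
      ← hausdorffMeasure_frontier_convexHull_vadd (-c) (A ∪ B), Set.vadd_set_union]
    have hA' : (-c +ᵥ A).Finite := hA.image _
    have hB' : (-c +ᵥ B).Finite := hB.image _
    have hA0 := exists_vadd_zero_mem_interior hcA
    have hB0 := exists_vadd_zero_mem_interior hcB
    exact (hausdorffMeasure_frontier_convexHull_union_le hA' hB' hA0 hB0).trans_lt
      (hausdorffMeasure_frontier_union_lt (convex_convexHull ℝ _) (hA'.isCompact_convexHull ℝ)
        (convex_convexHull ℝ _) (hB'.isCompact_convexHull ℝ) ⟨0, hA0, hB0⟩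
        (hausdorffMeasure_frontier_lt_top hA' hA0) (hausdorffMeasure_frontier_lt_top hB' hB0))
  unfold perim
  rw [← ENNReal.toReal_add hAfin.ne hBfin.ne]
  exact (ENNReal.toReal_lt_toReal (hlt.trans_le le_top).ne
    (ENNReal.add_lt_top.2 ⟨hAfin, hBfin⟩).ne).2 hlt

theorem delta_min_not_partially_enclosing {ι : Type*} [DecidableEq ι]
    (V : ι → Finset (EuclideanSpace ℝ (Fin 2))) (hV : ∀ i, (V i).Nonempty)
    (hint : ∀ i, (interior (convexHull ℝ (V i : Set (EuclideanSpace ℝ (Fin 2))))).Nonempty)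
    (C S : Finset ι) (hS : S.Nonempty) (hSC : S ⊆ C)
    (hmin : ∀ T ⊆ C, delta V S ≤ delta V T) :
    ∀ j ∈ C \ S,
      Disjoint (interior (convexHull ℝ (V j : Set (EuclideanSpace ℝ (Fin 2)))))
        (convexHull ℝ (⋃ i ∈ S, (V i : Set (EuclideanSpace ℝ (Fin 2))))) := by
  intro j hj
  obtain ⟨hjC, hjS⟩ := Finset.mem_sdiff.1 hj
  rw [Set.disjoint_iff_inter_eq_empty, ← Set.not_nonempty_iff_eq_empty]
  intro hne
  set A : Set (EuclideanSpace ℝ (Fin 2)) := ⋃ i ∈ S, (V i : Set (EuclideanSpace ℝ (Fin 2)))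
    with hA
  have hAfin : A.Finite := S.finite_toSet.biUnion fun i _ => (V i).finite_toSet
  have hAint : (interior (convexHull ℝ A)).Nonempty := by
    obtain ⟨i, hi⟩ := hS
    exact (hint i).mono (interior_mono (convexHull_mono
      (Set.subset_biUnion_of_mem (u := fun i => (V i : Set (EuclideanSpace ℝ (Fin 2)))) hi)))
  have hoverlap : (interior (convexHull ℝ A) ∩
      interior (convexHull ℝ (V j : Set (EuclideanSpace ℝ (Fin 2))))).Nonempty := by
    obtain ⟨x, hxj, hxA⟩ := hne
    have hx : x ∈ closure (interior (convexHull ℝ A)) := by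
      rw [(convex_convexHull ℝ A).closure_interior_eq_closure_of_nonempty_interior hAint]
      exact subset_closure hxA
    rw [Set.inter_comm]
    exact mem_closure_iff.1 hx _ isOpen_interior hxj
  have hlt := perim_convexHull_union_lt hAfin (V j).finite_toSet hoverlap
  have hle := hmin (insert j S) (Finset.insert_subset hjC hSC)
  simp only [delta, Finset.sum_insert hjS] at hle
  have h1 : hullPerim V S = perim (convexHull ℝ A) := rfl
  have h2 : hullPerim V {j} = perim (convexHull ℝ (V j : Set (EuclideanSpace ℝ (Fin 2)))) := by
    simp [hullPerim]
  have h3 : hullPerim V (insert j S) =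
      perim (convexHull ℝ (A ∪ (V j : Set (EuclideanSpace ℝ (Fin 2))))) := by
    rw [hullPerim, Finset.set_biUnion_insert, Set.union_comm]
  linarith
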